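/- arXiv:1001.1994 — 2 statements merged into one kernel-verified Lean document; each statement's English description precedes it below -/
import Mathlib

section
/- An Egorov space (ℝⁿ, g_f) is locally symmetric (∇R = 0) if and only if its defining function satisfies (f')² - 2ff'' = k·f² for some real constant k. -/
noncomputable section

/-- Partial derivative of a function on `ℝⁿ` in the `a`-th coordinate direction. -/
def pd {N : ℕ} (a : Fin N) (h : (Fin N → ℝ) → ℝ) (x : Fin N → ℝ) : ℝ :=
  deriv (fun t => h (Function.update x a t)) (x a)

/-- The index of the coordinate `x_n` (dimension `n = m+3`). -/
def lastIdx (m : ℕ) : Fin (m + 3) := ⟨m + 2, by omega⟩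

/-- The index of the coordinate `x_{n-1}`. -/
def penIdx (m : ℕ) : Fin (m + 3) := ⟨m + 1, by omega⟩

/-- The Egorov metric `g_f = f(x_n) Σ_{i=1}^{n-2} (dx_i)² + 2 dx_{n-1} dx_n` on `ℝⁿ`, `n = m+3`. -/
def gE (m : ℕ) (f : ℝ → ℝ) (x : Fin (m + 3) → ℝ) (i j : Fin (m + 3)) : ℝ :=
  if i = j ∧ (i : ℕ) < m + 1 then f (x (lastIdx m))
  else if (i = penIdx m ∧ j = lastIdx m) ∨ (i = lastIdx m ∧ j = penIdx m) then 1
  else 0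

/-- Christoffel symbols `Γ^k_{ij}` of the Egorov metric:
`∇_{∂_i}∂_i = -(f'/2)∂_{n-1}`, `∇_{∂_i}∂_n = (f'/(2f))∂_i` for spatial `i`, all others zero. -/
def ΓE (m : ℕ) (f : ℝ → ℝ) (x : Fin (m + 3) → ℝ) (k i j : Fin (m + 3)) : ℝ :=
  if (i : ℕ) < m + 1 ∧ j = i ∧ k = penIdx m then -(deriv f (x (lastIdx m)) / 2)
  else if (i : ℕ) < m + 1 ∧ j = lastIdx m ∧ k = i then
    deriv f (x (lastIdx m)) / (2 * f (x (lastIdx m)))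
  else if (j : ℕ) < m + 1 ∧ i = lastIdx m ∧ k = j then
    deriv f (x (lastIdx m)) / (2 * f (x (lastIdx m)))
  else 0

/-- Component on `∂_l` of `R(∂_i,∂_j)∂_k`, with the sign convention
`R(X,Y) = ∇_{[X,Y]} - [∇_X, ∇_Y]` (in coordinates `[∂_i,∂_j] = 0`). -/
def RopE (m : ℕ) (f : ℝ → ℝ) (x : Fin (m + 3) → ℝ) (i j k l : Fin (m + 3)) : ℝ :=
  -(pd i (fun y => ΓE m f y l j k) x - pd j (fun y => ΓE m f y l i k) x
    + ∑ s, (ΓE m f x l i s * ΓE m f x s j k - ΓE m f x l j s * ΓE m f x s i k))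

/-- The (0,4)-curvature tensor `R(∂_i,∂_j,∂_k,∂_h) = ⟨R(∂_i,∂_j)∂_k, ∂_h⟩`. -/
def R4E (m : ℕ) (f : ℝ → ℝ) (x : Fin (m + 3) → ℝ) (i j k h : Fin (m + 3)) : ℝ :=
  ∑ l, RopE m f x i j k l * gE m f x l h

/-- Ricci tensor `Ric(X,Y) = trace (Z ↦ R(X,Z)Y)`. -/
def RicE (m : ℕ) (f : ℝ → ℝ) (x : Fin (m + 3) → ℝ) (i j : Fin (m + 3)) : ℝ :=
  ∑ k, RopE m f x i k j k

/-- Covariant derivative `(∇_{∂_a} R)(∂_i,∂_j,∂_k,∂_h)` of the (0,4)-curvature tensor. -/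
def covR4E (m : ℕ) (f : ℝ → ℝ) (x : Fin (m + 3) → ℝ) (a i j k h : Fin (m + 3)) : ℝ :=
  pd a (fun y => R4E m f y i j k h) x
    - ∑ s, (ΓE m f x s a i * R4E m f x s j k h + ΓE m f x s a j * R4E m f x i s k h
      + ΓE m f x s a k * R4E m f x i j s h + ΓE m f x s a h * R4E m f x i j k s)

/-- Covariant derivative `(∇_{∂_a} Ric)(∂_i,∂_j)` of the Ricci tensor. -/
def covRicE (m : ℕ) (f : ℝ → ℝ) (x : Fin (m + 3) → ℝ) (a i j : Fin (m + 3)) : ℝ :=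
  pd a (fun y => RicE m f y i j) x
    - ∑ s, (ΓE m f x s a i * RicE m f x s j + ΓE m f x s a j * RicE m f x i s)

/-- Covariant derivative of the curvature operator, `(∇_{∂_a} R)(∂_i,∂_j)∂_k` component `l`. -/
def covRopE (m : ℕ) (f : ℝ → ℝ) (x : Fin (m + 3) → ℝ) (a i j k l : Fin (m + 3)) : ℝ :=
  pd a (fun y => RopE m f y i j k l) x
    + ∑ s, (ΓE m f x l a s * RopE m f x i j k s - ΓE m f x s a i * RopE m f x s j k l
      - ΓE m f x s a j * RopE m f x i s k l - ΓE m f x s a k * RopE m f x i j s l)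

/-- The matrix of the curvature operator `R(u,v)` in the coordinate frame. -/
def RMatE (m : ℕ) (f : ℝ → ℝ) (x : Fin (m + 3) → ℝ) (u v : Fin (m + 3) → ℝ) :
    Matrix (Fin (m + 3)) (Fin (m + 3)) ℝ :=
  Matrix.of fun l k => ∑ i, ∑ j, u i * v j * RopE m f x i j k l

/-- The matrix of the Jacobi operator `J_u = R(u,·)u` in the coordinate frame. -/
def JMatE (m : ℕ) (f : ℝ → ℝ) (x : Fin (m + 3) → ℝ) (u : Fin (m + 3) → ℝ) :
    Matrix (Fin (m + 3)) (Fin (m + 3)) ℝ :=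
  Matrix.of fun l k => ∑ i, ∑ j, u i * u j * RopE m f x i k j l

/-- The matrix of the Szabó operator `S_u = (∇_u R)(u,·)u` in the coordinate frame. -/
def SMatE (m : ℕ) (f : ℝ → ℝ) (x : Fin (m + 3) → ℝ) (u : Fin (m + 3) → ℝ) :
    Matrix (Fin (m + 3)) (Fin (m + 3)) ℝ :=
  Matrix.of fun l k => ∑ a, ∑ i, ∑ j, u a * u i * u j * covRopE m f x a i k j l

/-- The inner product of tangent vectors with respect to the Egorov metric. -/
def gdotE (m : ℕ) (f : ℝ → ℝ) (x : Fin (m + 3) → ℝ) (u v : Fin (m + 3) → ℝ) : ℝ :=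
  ∑ i, ∑ j, gE m f x i j * u i * v j

/-- The scalar function `((f')² - 2 f f'')/(4 f²)`. -/
def cE (f : ℝ → ℝ) (t : ℝ) : ℝ :=
  ((deriv f t) ^ 2 - 2 * f t * deriv (deriv f) t) / (4 * (f t) ^ 2)

/-- The matrix of the Ricci operator: only nonzero entry at position `(n-1, n)`. -/
def QMatE (m : ℕ) (f : ℝ → ℝ) (x : Fin (m + 3) → ℝ) :
    Matrix (Fin (m + 3)) (Fin (m + 3)) ℝ :=
  Matrix.of fun i j =>
    if i = penIdx m ∧ j = lastIdx m then ((m : ℝ) + 1) * cE f (x (lastIdx m)) else 0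

/-- Indicator of the last index. -/
def eL (m : ℕ) (i : Fin (m + 3)) : ℝ := if i = lastIdx m then 1 else 0
/-- Indicator of the penultimate index. -/
def eP (m : ℕ) (i : Fin (m + 3)) : ℝ := if i = penIdx m then 1 else 0
/-- Indicator of the spatial indices. -/
def eS (m : ℕ) (i : Fin (m + 3)) : ℝ := if (i : ℕ) < m + 1 then 1 else 0
/-- Spatial Kronecker delta. -/
def eD (m : ℕ) (i j : Fin (m + 3)) : ℝ := if i = j ∧ (i : ℕ) < m + 1 then 1 else 0

lemma eD_comm (m : ℕ) (i j : Fin (m + 3)) : eD m i j = eD m j i := by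
  unfold eD; congr 1; apply propext
  constructor <;> (rintro ⟨rfl, h⟩; exact ⟨rfl, h⟩)

lemma eD_pen_left (m : ℕ) (j : Fin (m + 3)) : eD m (penIdx m) j = 0 := by
  simp [eD, penIdx]
lemma eD_last_left (m : ℕ) (j : Fin (m + 3)) : eD m (lastIdx m) j = 0 := by
  simp [eD, lastIdx]
lemma eD_pen_right (m : ℕ) (j : Fin (m + 3)) : eD m j (penIdx m) = 0 := by
  rw [eD_comm, eD_pen_left]
lemma eD_last_right (m : ℕ) (j : Fin (m + 3)) : eD m j (lastIdx m) = 0 := by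
  rw [eD_comm, eD_last_left]
lemma eL_pen (m : ℕ) : eL m (penIdx m) = 0 := by
  simp [eL, penIdx, lastIdx]
lemma eL_last (m : ℕ) : eL m (lastIdx m) = 1 := by simp [eL]
lemma eP_pen (m : ℕ) : eP m (penIdx m) = 1 := by simp [eP]
lemma eP_last (m : ℕ) : eP m (lastIdx m) = 0 := by
  simp [eP, penIdx, lastIdx]
lemma eS_eL (m : ℕ) (i : Fin (m + 3)) : eS m i * eL m i = 0 := by
  unfold eS eL; split_ifs with h1 h2 <;> simp_all [lastIdx]
lemma eS_eP (m : ℕ) (i : Fin (m + 3)) : eS m i * eP m i = 0 := by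
  unfold eS eP; split_ifs with h1 h2 <;> simp_all [penIdx]
lemma eS_eD (m : ℕ) (i j : Fin (m + 3)) : eS m i * eD m i j = eD m i j := by
  unfold eS eD; grind
lemma eS_eD' (m : ℕ) (i j : Fin (m + 3)) : eS m i * eD m j i = eD m j i := by
  rw [eD_comm, eS_eD]

lemma sum_eL (m : ℕ) (X : Fin (m + 3) → ℝ) : ∑ s, eL m s * X s = X (lastIdx m) := by
  simp [eL]
lemma sum_eP (m : ℕ) (X : Fin (m + 3) → ℝ) : ∑ s, eP m s * X s = X (penIdx m) := by
  simp [eP]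
lemma sum_eD (m : ℕ) (i : Fin (m + 3)) (X : Fin (m + 3) → ℝ) :
    ∑ s, eD m i s * X s = eS m i * X i := by
  simp [eD, eS, ite_and]

lemma gE_eq (m : ℕ) (f : ℝ → ℝ) (x : Fin (m + 3) → ℝ) (i j : Fin (m + 3)) :
    gE m f x i j = f (x (lastIdx m)) * eD m i j + eP m i * eL m j + eL m i * eP m j := by
  have hne : penIdx m ≠ lastIdx m := by simp [penIdx, lastIdx]
  have h1 : ¬ ((penIdx m : Fin (m+3)) : ℕ) < m + 1 := by simp [penIdx]
  have h2 : ¬ ((lastIdx m : Fin (m+3)) : ℕ) < m + 1 := by simp [lastIdx]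
  unfold gE eD eP eL
  by_cases hp : i = penIdx m
  · subst hp; simp [h1, hne]
  by_cases hl : i = lastIdx m
  · subst hl; simp [h2, hne.symm]
  simp [hp, hl]

/-- Half the derivative. -/
def pF (f : ℝ → ℝ) (t : ℝ) : ℝ := deriv f t / 2
/-- Half the logarithmic derivative. -/
def qF (f : ℝ → ℝ) (t : ℝ) : ℝ := deriv f t / (2 * f t)
/-- The curvature component. -/
def aF (f : ℝ → ℝ) (t : ℝ) : ℝ :=
  ((deriv f t) ^ 2 - 2 * f t * deriv (deriv f) t) / (4 * f t)

lemma ΓE_eq (m : ℕ) (f : ℝ → ℝ) (x : Fin (m + 3) → ℝ) (k i j : Fin (m + 3)) :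
    ΓE m f x k i j = -pF f (x (lastIdx m)) * (eD m i j * eP m k)
      + qF f (x (lastIdx m)) * (eD m i k * eL m j + eD m j k * eL m i) := by
  have hne : penIdx m ≠ lastIdx m := by simp [penIdx, lastIdx]
  have h1 : ¬ ((penIdx m : Fin (m+3)) : ℕ) < m + 1 := by simp [penIdx]
  have h2 : ¬ ((lastIdx m : Fin (m+3)) : ℕ) < m + 1 := by simp [lastIdx]
  unfold ΓE eD eP eL pF qF
  grind

lemma pd_last (m : ℕ) (φ : ℝ → ℝ) (x : Fin (m + 3) → ℝ) (i : Fin (m + 3)) :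
    pd i (fun y => φ (y (lastIdx m))) x = eL m i * deriv φ (x (lastIdx m)) := by
  unfold pd eL
  by_cases h : i = lastIdx m
  · subst h; simp
  · simp [h, Function.update_of_ne (Ne.symm h)]

lemma sum_Γ_up (m : ℕ) (f : ℝ → ℝ) (x : Fin (m + 3) → ℝ) (i j : Fin (m + 3))
    (X : Fin (m + 3) → ℝ) :
    ∑ s, ΓE m f x s i j * X s = -pF f (x (lastIdx m)) * (eD m i j * X (penIdx m))
      + qF f (x (lastIdx m)) * (eS m i * X i * eL m j + eS m j * X j * eL m i) := by
  rw [← sum_eP m X, ← sum_eD m i X, ← sum_eD m j X]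
  simp only [Finset.mul_sum, Finset.sum_mul, ← Finset.sum_add_distrib]
  refine Finset.sum_congr rfl fun s _ => ?_
  rw [ΓE_eq]; ring

lemma hd0 {f : ℝ → ℝ} (hf : ContDiff ℝ (⊤ : ℕ∞) f) (t : ℝ) : HasDerivAt f (deriv f t) t :=
  (hf.differentiable (by simp) t).hasDerivAt
lemma smooth1 {f : ℝ → ℝ} (hf : ContDiff ℝ (⊤ : ℕ∞) f) : ContDiff ℝ (⊤ : ℕ∞) (deriv f) :=
  (contDiff_infty_iff_deriv.1 hf).2
lemma hd1 {f : ℝ → ℝ} (hf : ContDiff ℝ (⊤ : ℕ∞) f) (t : ℝ) : HasDerivAt (deriv f) (deriv (deriv f) t) t := hd0 (smooth1 hf) t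

lemma hdp {f : ℝ → ℝ} (hf : ContDiff ℝ (⊤ : ℕ∞) f) (t : ℝ) : HasDerivAt (pF f) (deriv (deriv f) t / 2) t := (hd1 hf t).div_const 2

lemma hdq {f : ℝ → ℝ} (hf : ContDiff ℝ (⊤ : ℕ∞) f)
    (hfpos : ∀ t, 0 < f t) (t : ℝ) : HasDerivAt (qF f)
    ((deriv (deriv f) t * (2 * f t) - deriv f t * (2 * deriv f t)) / (2 * f t) ^ 2) t :=
  (hd1 hf t).div ((hd0 hf t).const_mul 2) (by have := hfpos t; positivity)

lemma da {f : ℝ → ℝ} (hf : ContDiff ℝ (⊤ : ℕ∞) f)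
    (hfpos : ∀ t, 0 < f t) (t : ℝ) : DifferentiableAt ℝ (aF f) t := by
  have h0 := (hd0 hf t).differentiableAt
  have h1 := (hd1 hf t).differentiableAt
  have h2 := (hd1 (smooth1 hf) t).differentiableAt
  have h3 := (hd0 (smooth1 (smooth1 hf)) t).differentiableAt
  have := (hfpos t).ne'
  unfold aF
  refine DifferentiableAt.div (by fun_prop) (by fun_prop) (by positivity)

lemma pq1 {f : ℝ → ℝ} (hf : ContDiff ℝ (⊤ : ℕ∞) f)
    (hfpos : ∀ t, 0 < f t) (t : ℝ) : deriv (pF f) t - pF f t * qF f t = - aF f t := by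
  have := (hfpos t).ne'
  rw [(hdp hf t).deriv]; unfold pF qF aF; field_simp; ring

lemma pq2 {f : ℝ → ℝ} (hf : ContDiff ℝ (⊤ : ℕ∞) f)
    (hfpos : ∀ t, 0 < f t) (t : ℝ) : deriv (qF f) t + qF f t ^ 2 = - aF f t / f t := by
  have := (hfpos t).ne'
  rw [(hdq hf hfpos t).deriv]; unfold qF aF; field_simp; ring

lemma pd_Γ {f : ℝ → ℝ} (hf : ContDiff ℝ (⊤ : ℕ∞) f)
    (hfpos : ∀ t, 0 < f t) (m : ℕ) (x : Fin (m + 3) → ℝ) (a k i j : Fin (m + 3)) :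
    pd a (fun y => ΓE m f y k i j) x = eL m a * (-deriv (pF f) (x (lastIdx m)) * (eD m i j * eP m k)
      + deriv (qF f) (x (lastIdx m)) * (eD m i k * eL m j + eD m j k * eL m i)) := by
  simp only [ΓE_eq]
  rw [pd_last m (fun t => -pF f t * (eD m i j * eP m k)
      + qF f t * (eD m i k * eL m j + eD m j k * eL m i))]
  congr 1
  have hp := (hdp hf (x (lastIdx m))).differentiableAt.hasDerivAt
  have hq := (hdq hf hfpos (x (lastIdx m))).differentiableAt.hasDerivAt
  exact ((hp.neg.mul_const _).add (hq.mul_const _)).deriv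

lemma Rop_eq {f : ℝ → ℝ} (hf : ContDiff ℝ (⊤ : ℕ∞) f)
    (hfpos : ∀ t, 0 < f t) (m : ℕ) (x : Fin (m + 3) → ℝ) (i j k l : Fin (m + 3)) :
    RopE m f x i j k l = aF f (x (lastIdx m)) * eP m l * (eL m j * eD m i k - eL m i * eD m j k)
      + aF f (x (lastIdx m)) / f (x (lastIdx m)) * eL m k
        * (eL m i * eD m j l - eL m j * eD m i l) := by
  have key : ∀ i j : Fin (m + 3), ∑ s, ΓE m f x l i s * ΓE m f x s j k =
      qF f (x (lastIdx m)) * (eL m k * (-pF f (x (lastIdx m)) * (eD m i j * eP m l)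
          + qF f (x (lastIdx m)) * (eD m j l * eL m i))
        + eL m j * (-pF f (x (lastIdx m)) * (eD m i k * eP m l)
          + qF f (x (lastIdx m)) * (eD m k l * eL m i))) := by
    intro i j
    simp only [mul_comm (ΓE m f x l i _)]
    rw [sum_Γ_up]
    simp only [ΓE_eq, eD_pen_left, eD_pen_right, eL_pen]
    have a1 := eS_eL m j
    have a2 := eS_eL m k
    have b1 := eS_eD' m j i
    have b2 := eS_eD' m k i
    have c1 := eS_eD m j l
    have c2 := eS_eD m k l
    grind
  unfold RopE
  rw [Finset.sum_sub_distrib, key, key, pd_Γ hf hfpos, pd_Γ hf hfpos, eD_comm m j i]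
  have e1 := pq1 hf hfpos (x (lastIdx m))
  have e2 := pq2 hf hfpos (x (lastIdx m))
  have e3 : aF f (x (lastIdx m)) / f (x (lastIdx m)) =
    -(deriv (qF f) (x (lastIdx m)) + qF f (x (lastIdx m)) ^ 2) := by rw [e2]; ring
  have e4 : aF f (x (lastIdx m)) = -(deriv (pF f) (x (lastIdx m))
    - pF f (x (lastIdx m)) * qF f (x (lastIdx m))) := by rw [e1]; ring
  rw [e3, e4]
  ring

/-- Constant algebraic part of the curvature. -/
def bB (m : ℕ) (i j k h : Fin (m + 3)) : ℝ :=
  eL m h * (eL m j * eD m i k - eL m i * eD m j k)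
    + eL m k * (eL m i * eD m j h - eL m j * eD m i h)

lemma R4_eq {f : ℝ → ℝ} (hf : ContDiff ℝ (⊤ : ℕ∞) f)
    (hfpos : ∀ t, 0 < f t) (m : ℕ) (x : Fin (m + 3) → ℝ) (i j k h : Fin (m + 3)) :
    R4E m f x i j k h = aF f (x (lastIdx m)) * bB m i j k h := by
  have hne := (hfpos (x (lastIdx m))).ne'
  have : ∀ l, RopE m f x i j k l * gE m f x l h =
      eP m l * (RopE m f x i j k l * eL m h) + eL m l * (RopE m f x i j k l * eP m h)
       + f (x (lastIdx m)) * (eD m h l * RopE m f x i j k l) := by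
    intro l; rw [gE_eq, eD_comm m l h]; ring
  unfold R4E
  simp only [this, Finset.sum_add_distrib, ← Finset.mul_sum, sum_eP, sum_eL, sum_eD]
  simp only [Rop_eq hf hfpos, eD_pen_right, eD_last_right, eP_pen, eP_last]
  have a := eS_eP m h
  have b1 := eS_eD' m h i
  have b2 := eS_eD' m h j
  unfold bB
  set A := aF f (x (lastIdx m))
  set F := f (x (lastIdx m))
  have : F * (eS m h * (A * eP m h * (eL m j * eD m i k - eL m i * eD m j k)
      + A / F * eL m k * (eL m i * eD m j h - eL m j * eD m i h)))
    = A * eL m k * (eL m i * eD m j h - eL m j * eD m i h) := by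
    calc _ = F * (A * (eS m h * eP m h) * (eL m j * eD m i k - eL m i * eD m j k)
      + A / F * eL m k * (eL m i * (eS m h * eD m j h) - eL m j * (eS m h * eD m i h))) := by ring
      _ = _ := by rw [a, b1, b2]; field_simp; ring
  rw [this]; ring

lemma cov_eq {f : ℝ → ℝ} (hf : ContDiff ℝ (⊤ : ℕ∞) f)
    (hfpos : ∀ t, 0 < f t) (m : ℕ) (x : Fin (m + 3) → ℝ) (a i j k h : Fin (m + 3)) :
    covR4E m f x a i j k h = eL m a * (deriv (aF f) (x (lastIdx m))
      - 2 * qF f (x (lastIdx m)) * aF f (x (lastIdx m))) * bB m i j k h := by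
  unfold covR4E
  simp only [Finset.sum_add_distrib, sum_Γ_up]
  simp only [R4_eq hf hfpos]
  rw [pd_last m (fun t => aF f t * bB m i j k h),
    ((da hf hfpos (x (lastIdx m))).hasDerivAt.mul_const _).deriv]
  have p1 : bB m (penIdx m) j k h = 0 := by simp [bB, eD_pen_left, eL_pen]
  have p2 : bB m i (penIdx m) k h = 0 := by simp [bB, eD_pen_left, eL_pen]
  have p3 : bB m i j (penIdx m) h = 0 := by simp [bB, eD_pen_right, eL_pen]
  have p4 : bB m i j k (penIdx m) = 0 := by simp [bB, eD_pen_right, eL_pen]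
  have s1 : ∀ u j k h, eS m u * bB m u j k h = eL m j * (eL m h * eD m u k - eL m k * eD m u h) := by
    intro u j k h; unfold bB
    linear_combination (eL m j * eL m h) * eS_eD m u k - (eL m j * eL m k) * eS_eD m u h
      + (-eL m h * eD m j k + eL m k * eD m j h) * eS_eL m u
  have s2 : ∀ u i k h, eS m u * bB m i u k h = -eL m i * (eL m h * eD m u k - eL m k * eD m u h) := by
    intro u i k h; rw [← neg_inj]
    have := s1 u i k h
    unfold bB at *
    linear_combination this
  have s3 : ∀ u i j h, eS m u * bB m i j u h = eL m h * (eL m j * eD m i u - eL m i * eD m j u) := by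
    intro u i j h; unfold bB
    linear_combination (eL m h * eL m j) * eS_eD' m u i - (eL m h * eL m i) * eS_eD' m u j
      + (eL m i * eD m j h - eL m j * eD m i h) * eS_eL m u
  have s4 : ∀ u i j k, eS m u * bB m i j k u = -eL m k * (eL m j * eD m i u - eL m i * eD m j u) := by
    intro u i j k
    have := s3 u i j k
    unfold bB at *
    linear_combination -this
  have r : ∀ u v : Fin (m + 3), ∀ b : ℝ, eS m u * (aF f (x (lastIdx m)) * b) * eL m v
      = aF f (x (lastIdx m)) * (eS m u * b) * eL m v := by intros; ring
  simp only [p1, p2, p3, p4, r, s1, s2, s3, s4]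
  rw [eD_comm m i a, eD_comm m j a]
  unfold bB
  ring

/-- an Egorov space is locally symmetric (`∇R = 0`) if and only if
`(f')² - 2ff'' = k·f²` for some real constant `k`. -/
theorem egorov_locally_symmetric_iff (m : ℕ) (f : ℝ → ℝ) (hf : ContDiff ℝ (⊤ : ℕ∞) f)
    (hfpos : ∀ t, 0 < f t) :
    (∀ (x : Fin (m + 3) → ℝ) (a i j k h : Fin (m + 3)), covR4E m f x a i j k h = 0) ↔
    (∃ k : ℝ, ∀ t : ℝ,
      (deriv f t) ^ 2 - 2 * f t * deriv (deriv f) t = k * (f t) ^ 2) := by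
  constructor
  · intro H
    have h0 : ∀ t, deriv (aF f) t - 2 * qF f t * aF f t = 0 := by
      intro t
      have := H (fun _ => t) (lastIdx m) ⟨0, by omega⟩ (lastIdx m) ⟨0, by omega⟩ (lastIdx m)
      rw [cov_eq hf hfpos] at this
      simpa [bB, eL, eD, lastIdx] using this
    have hdc : ∀ t, HasDerivAt (fun s => aF f s / f s)
        ((deriv (aF f) t * f t - aF f t * deriv f t) / f t ^ 2) t := fun t =>
      (da hf hfpos t).hasDerivAt.div (hd0 hf t) (hfpos t).ne'
    have hc := is_const_of_deriv_eq_zero (fun t => (hdc t).differentiableAt) (fun t => by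
      have h1 := h0 t
      have h2 := (hfpos t).ne'
      rw [(hdc t).deriv, sub_eq_zero.1 h1]
      unfold qF; field_simp; ring)
    refine ⟨4 * (aF f 0 / f 0), fun t => ?_⟩
    have h2 := (hfpos t).ne'
    rw [← hc t 0]
    unfold aF; field_simp
  · rintro ⟨c, hc⟩ x a i j k h
    have hA : aF f = fun t => c / 4 * f t := by
      funext t
      have h2 := (hfpos t).ne'
      unfold aF; rw [hc t]; field_simp
    have h2 := (hfpos (x (lastIdx m))).ne'
    rw [cov_eq hf hfpos, hA, ((hd0 hf (x (lastIdx m))).const_mul (c / 4)).deriv]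
    have : c / 4 * deriv f (x (lastIdx m)) - 2 * qF f (x (lastIdx m)) * (c / 4 * f (x (lastIdx m))) = 0 := by
      unfold qF; field_simp; ring
    rw [this]; ring
end
end

section
/- Every Egorov space is semi-symmetric: R(u,v)·R = 0 for all tangent vectors u, v, where R(u,v) acts as a derivation on the curvature tensor. Concretely, for all indices, (R(∂_a,∂_b)·R)(∂_c,∂_d,∂_e,∂_h) = -R(R(∂_a,∂_b)∂_c,∂_d,∂_e,∂_h) - R(∂_c,R(∂_a,∂_b)∂_d,∂_e,∂_h) - R(∂_c,∂_d,R(∂_a,∂_b)∂_e,∂_h) - R(∂_c,∂_d,∂_e,R(∂_a,∂_b)∂_h) = 0. -/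
noncomputable section

/-- Christoffel pattern with abstract values. -/
def GP (m : ℕ) (α β : ℝ) (k i j : Fin (m + 3)) : ℝ :=
  if (i : ℕ) < m + 1 ∧ j = i ∧ k = penIdx m then α
  else if (i : ℕ) < m + 1 ∧ j = lastIdx m ∧ k = i then β
  else if (j : ℕ) < m + 1 ∧ i = lastIdx m ∧ k = j then β
  else 0

/-- The curvature pattern `R(∂_i,∂_L)`. -/
def KP (m : ℕ) (F : ℝ) (i j k l : Fin (m + 3)) : ℝ :=
  if (i : ℕ) < m + 1 ∧ j = lastIdx m then
    (if k = lastIdx m ∧ l = i then 1 else 0) - (if k = i ∧ l = penIdx m then F else 0)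
  else 0

/-- The lowered curvature pattern. -/
def LP (m : ℕ) (i j k l : Fin (m + 3)) : ℝ :=
  if (i : ℕ) < m + 1 ∧ j = lastIdx m then
    (if k = lastIdx m ∧ l = i then 1 else 0) - (if k = i ∧ l = lastIdx m then 1 else 0)
  else 0

theorem pen_ns (m : ℕ) : ¬ ((penIdx m : Fin (m+3)) : ℕ) < m + 1 := by simp [penIdx]
theorem last_ns (m : ℕ) : ¬ ((lastIdx m : Fin (m+3)) : ℕ) < m + 1 := by simp [lastIdx]
theorem pen_ne (m : ℕ) : penIdx m ≠ lastIdx m := by simp [lastIdx, penIdx]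
theorem tri (m : ℕ) (i : Fin (m+3)) : (i : ℕ) < m + 1 ∨ i = penIdx m ∨ i = lastIdx m := by
  have := i.2
  simp only [lastIdx, penIdx, Fin.ext_iff]
  omega

theorem sum_GP (m : ℕ) (α β : ℝ) (X : Fin (m+3) → ℝ) (j k : Fin (m+3)) :
    ∑ s, X s * GP m α β s j k =
      (if (j : ℕ) < m + 1 ∧ k = j then α * X (penIdx m) else 0)
      + (if (j : ℕ) < m + 1 ∧ k = lastIdx m then β * X j else 0)
      + (if (k : ℕ) < m + 1 ∧ j = lastIdx m then β * X k else 0) := by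
  have h1 := pen_ns m
  have h2 := last_ns m
  have h3 := pen_ne m
  have key : ∀ s, X s * GP m α β s j k =
      (if s = penIdx m then (if (j : ℕ) < m + 1 ∧ k = j then α * X (penIdx m) else 0) else 0)
      + (if s = j then (if (j : ℕ) < m + 1 ∧ k = lastIdx m then β * X j else 0) else 0)
      + (if s = k then (if (k : ℕ) < m + 1 ∧ j = lastIdx m then β * X k else 0) else 0) := by
    intro s
    unfold GP
    grind
  simp only [key, Finset.sum_add_distrib, Finset.sum_ite_eq', Finset.mem_univ, if_true]

theorem sum_KP (m : ℕ) (F : ℝ) (X : Fin (m+3) → ℝ) (i j k : Fin (m+3)) :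
    ∑ s, KP m F i j k s * X s =
      if (i : ℕ) < m + 1 ∧ j = lastIdx m then
        (if k = lastIdx m then X i else 0) - (if k = i then F * X (penIdx m) else 0)
      else 0 := by
  have key : ∀ s, KP m F i j k s * X s =
      (if s = i then (if (i : ℕ) < m + 1 ∧ j = lastIdx m ∧ k = lastIdx m then X i else 0) else 0)
      - (if s = penIdx m then
        (if (i : ℕ) < m + 1 ∧ j = lastIdx m ∧ k = i then F * X (penIdx m) else 0) else 0) := by
    intro s
    unfold KP
    grind
  simp only [key, Finset.sum_sub_distrib, Finset.sum_ite_eq', Finset.mem_univ, if_true]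
  grind

theorem GammaE_eq (m : ℕ) (f : ℝ → ℝ) (x : Fin (m+3) → ℝ) (k i j : Fin (m+3)) :
    ΓE m f x k i j = GP m (-(deriv f (x (lastIdx m)) / 2))
      (deriv f (x (lastIdx m)) / (2 * f (x (lastIdx m)))) k i j := rfl

theorem pd_Gamma (m : ℕ) (f : ℝ → ℝ) (hf : ContDiff ℝ (⊤ : ℕ∞) f)
    (hfpos : ∀ t, 0 < f t) (x : Fin (m+3) → ℝ) (a k i j : Fin (m+3)) :
    pd a (fun y => ΓE m f y k i j) x =
      if a = lastIdx m then
        GP m (-(deriv (deriv f) (x (lastIdx m)) / 2))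
          ((deriv (deriv f) (x (lastIdx m)) * f (x (lastIdx m)) - deriv f (x (lastIdx m)) ^ 2)
            / (2 * f (x (lastIdx m)) ^ 2)) k i j
      else 0 := by
  unfold pd
  split_ifs with h
  · subst h
    simp only [GammaE_eq, Function.update_self]
    generalize x (lastIdx m) = t
    have d1 : HasDerivAt f (deriv f t) t :=
      (hf.differentiable (by simp)).differentiableAt.hasDerivAt
    have hf' : ContDiff ℝ (⊤ : ℕ∞) (deriv f) := (contDiff_infty_iff_deriv.1 hf).2
    have d2 : HasDerivAt (deriv f) (deriv (deriv f) t) t :=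
      (hf'.differentiable (by simp)).differentiableAt.hasDerivAt
    have hne := (hfpos t).ne'
    unfold GP
    split_ifs
    · exact (d2.div_const 2).neg.deriv
    · refine ((d2.div (d1.const_mul 2) (by positivity)).deriv).trans ?_
      field_simp
    · refine ((d2.div (d1.const_mul 2) (by positivity)).deriv).trans ?_
      field_simp
    · simp
  · simp only [GammaE_eq, Function.update_of_ne (Ne.symm h)]
    simp

theorem RopE_eq (m : ℕ) (f : ℝ → ℝ) (hf : ContDiff ℝ (⊤ : ℕ∞) f)
    (hfpos : ∀ t, 0 < f t) (x : Fin (m+3) → ℝ) (i j k l : Fin (m+3)) :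
    RopE m f x i j k l = -cE f (x (lastIdx m)) *
      (KP m (f (x (lastIdx m))) i j k l - KP m (f (x (lastIdx m))) j i k l) := by
  unfold RopE
  simp only [pd_Gamma m f hf hfpos]
  simp only [GammaE_eq, Finset.sum_sub_distrib, sum_GP]
  have hne := (hfpos (x (lastIdx m))).ne'
  have r1 : cE f (x (lastIdx m)) =
      -((deriv (deriv f) (x (lastIdx m)) * f (x (lastIdx m)) - deriv f (x (lastIdx m)) ^ 2)
            / (2 * f (x (lastIdx m)) ^ 2))
      - (deriv f (x (lastIdx m)) / (2 * f (x (lastIdx m)))) ^ 2 := by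
    unfold cE
    field_simp
    ring
  have r2 : cE f (x (lastIdx m)) * f (x (lastIdx m)) =
      -(deriv (deriv f) (x (lastIdx m)) / 2)
      - (-(deriv f (x (lastIdx m)) / 2)) * (deriv f (x (lastIdx m)) / (2 * f (x (lastIdx m)))) := by
    unfold cE
    field_simp
    ring
  generalize -(deriv (deriv f) (x (lastIdx m)) / 2) = A' at *
  generalize (deriv (deriv f) (x (lastIdx m)) * f (x (lastIdx m)) - deriv f (x (lastIdx m)) ^ 2)
            / (2 * f (x (lastIdx m)) ^ 2) = B' at *
  generalize deriv f (x (lastIdx m)) / (2 * f (x (lastIdx m))) = B at *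
  generalize -(deriv f (x (lastIdx m)) / 2) = A at *
  generalize cE f (x (lastIdx m)) = C at *
  generalize f (x (lastIdx m)) = F at *
  clear hf hfpos
  have h1 := pen_ns m
  have h2 := last_ns m
  have h3 := pen_ne m
  have hs1 : ∀ q : Fin (m+3), (q : ℕ) < m + 1 → q ≠ penIdx m := by grind
  have hs2 : ∀ q : Fin (m+3), (q : ℕ) < m + 1 → q ≠ lastIdx m := by grind
  have hs3 : ∀ q : Fin (m+3), (q : ℕ) < m + 1 → penIdx m ≠ q := by grind
  have hs4 : ∀ q : Fin (m+3), (q : ℕ) < m + 1 → lastIdx m ≠ q := by grind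
  have h4 := h3.symm
  unfold GP KP
  rcases tri m i with hi | rfl | rfl <;> rcases tri m j with hj | rfl | rfl <;>
  rcases tri m k with hk | rfl | rfl <;> rcases tri m l with hl | rfl | rfl <;>
  simp only [*, h1, h2, h3, h4, hs1, hs2, hs3, hs4, ne_eq, not_false_eq_true, and_true, true_and,
    and_false, false_and, if_true, if_false, eq_self_iff_true, ite_self, mul_zero, sub_zero,
    add_zero, zero_add, neg_zero, sub_self] <;>
  clear hs1 hs2 hs3 hs4 <;> grind (splits := 20)

theorem R4E_eq (m : ℕ) (f : ℝ → ℝ) (hf : ContDiff ℝ (⊤ : ℕ∞) f)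
    (hfpos : ∀ t, 0 < f t) (x : Fin (m+3) → ℝ) (i j k l : Fin (m+3)) :
    R4E m f x i j k l = -cE f (x (lastIdx m)) * f (x (lastIdx m)) *
      (LP m i j k l - LP m j i k l) := by
  unfold R4E
  have h1 := pen_ns m
  have h2 := last_ns m
  have h3 := pen_ne m
  simp only [RopE_eq m f hf hfpos, mul_assoc, sub_mul, ← Finset.mul_sum,
    Finset.sum_sub_distrib, sum_KP]
  congr 1
  unfold gE LP
  grind

/-- every Egorov space is semi-symmetric: the curvature operator acts
trivially as a derivation on the curvature tensor,
`(R(∂_a,∂_b)·R)(∂_c,∂_d,∂_e,∂_h) = 0` for all indices. -/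
theorem egorov_semi_symmetric (m : ℕ) (f : ℝ → ℝ) (hf : ContDiff ℝ (⊤ : ℕ∞) f)
    (hfpos : ∀ t, 0 < f t) :
    ∀ (x : Fin (m + 3) → ℝ) (a b c d e h : Fin (m + 3)),
      -(∑ s, (RopE m f x a b c s * R4E m f x s d e h
        + RopE m f x a b d s * R4E m f x c s e h
        + RopE m f x a b e s * R4E m f x c d s h
        + RopE m f x a b h s * R4E m f x c d e s)) = 0 := by
  intro x a b c d e h
  have h1 := pen_ns m
  have h2 := last_ns m
  have h3 := pen_ne m
  simp only [RopE_eq m f hf hfpos, mul_assoc, sub_mul, Finset.sum_add_distrib, ← Finset.mul_sum,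
    Finset.sum_sub_distrib, sum_KP]
  have key : ∀ a b, (∑ s, KP m (f (x (lastIdx m))) a b c s * R4E m f x s d e h)
      + (∑ s, KP m (f (x (lastIdx m))) a b d s * R4E m f x c s e h)
      + (∑ s, KP m (f (x (lastIdx m))) a b e s * R4E m f x c d s h)
      + (∑ s, KP m (f (x (lastIdx m))) a b h s * R4E m f x c d e s) = 0 := by
    intro a b
    simp only [sum_KP, R4E_eq m f hf hfpos]
    generalize -cE f (x (lastIdx m)) * f (x (lastIdx m)) = C
    generalize f (x (lastIdx m)) = F
    by_cases hab : (a : ℕ) < m + 1 ∧ b = lastIdx m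
    · simp only [hab, and_self, if_true]
      obtain ⟨ha, rfl⟩ := hab
      have P1 : ∀ q r t, LP m (penIdx m) q r t = 0 := by unfold LP; grind
      have P2 : ∀ q r t, LP m q (penIdx m) r t = 0 := by unfold LP; grind
      have P3 : ∀ q r t, LP m q r (penIdx m) t = 0 := by unfold LP; grind
      have P4 : ∀ q r t, LP m q r t (penIdx m) = 0 := by unfold LP; grind
      simp only [P1, P2, P3, P4]
      simp only [sub_zero, mul_zero, ite_self]
      unfold LP
      by_cases c1 : c = lastIdx m <;> by_cases d1 : d = lastIdx m <;>
      by_cases e1 : e = lastIdx m <;> by_cases f1 : h = lastIdx m <;> grind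
    · simp only [hab, if_false, add_zero]
  have k1 := key a b
  have k2 := key b a
  simp only [sum_KP] at k1 k2
  linear_combination cE f (x (lastIdx m)) * (k1 - k2)
end
end
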